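/- Let R be a commutative ring and G a finite group. If M₁ and M₂ are projective modules over the group algebra R[G], then the tensor product M₁ ⊗_R M₂, equipped with the diagonal G-action, is again a projective R[G]-module. -/

import Mathlib

open MonoidAlgebra in
theorem aux_key {R G V : Type} [CommRing R] [Group G] [Fintype G] [AddCommGroup V] [Module R V]
    [Module (MonoidAlgebra R G) V] [IsScalarTower R (MonoidAlgebra R G) V]
    (a : MonoidAlgebra R G) (n : V) :
    ∑ g : G, (single g⁻¹ (1 : R)) • ((single g (1 : R) * a).coeff 1 • n) = a • n := by
  classical
  induction a using MonoidAlgebra.induction_linear with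
  | zero => simp
  | add a b ha hb => simp only [mul_add, coeff_add, Finsupp.add_apply, add_smul, smul_add,
      Finset.sum_add_distrib, ha, hb]
  | single h r =>
    rw [Finset.sum_eq_single h⁻¹]
    · simp only [single_mul_single]
      rw [← algebraMap_smul (MonoidAlgebra R G), smul_smul]
      simp
    · intro g _ hg
      have : g * h ≠ 1 := fun e => hg (eq_inv_of_mul_eq_one_left e)
      simp [single_mul_single, this]
    · simp

open MonoidAlgebra in
theorem aux_free (R G : Type) [CommRing R] : Module.Free R (MonoidAlgebra R G) := by
  infer_instance

open MonoidAlgebra in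
theorem aux_forward {R G V : Type} [CommRing R] [Group G] [Fintype G] [AddCommGroup V]
    [Module R V] [Module (MonoidAlgebra R G) V] [IsScalarTower R (MonoidAlgebra R G) V]
    (h : Module.Projective (MonoidAlgebra R G) V) :
    Module.Projective R V ∧ ∃ θ : V →ₗ[R] V,
      ∀ v, ∑ g : G, (single g⁻¹ (1 : R)) • θ (single g (1 : R) • v) = v := by
  classical
  obtain ⟨s, hs⟩ := Module.projective_def'.1 h
  have := aux_free R G
  refine ⟨Module.Projective.of_split (s.restrictScalars R)
    ((Finsupp.linearCombination (MonoidAlgebra R G) (id : V → V)).restrictScalars R) ?_, ?_⟩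
  · ext v
    exact LinearMap.congr_fun hs v
  let c : MonoidAlgebra R G →ₗ[R] R :=
    { toFun := fun a => a.coeff 1
      map_add' := by simp
      map_smul' := by simp }
  let L : (V →₀ MonoidAlgebra R G) →ₗ[R] V :=
    Finsupp.lsum R (fun n : V => (LinearMap.toSpanSingleton R V n) ∘ₗ c)
  have hL : ∀ x, ∑ g : G, (single g⁻¹ (1 : R)) • L (single g (1 : R) • x) =
      Finsupp.linearCombination (MonoidAlgebra R G) (id : V → V) x := by
    intro x
    induction x using Finsupp.induction_linear with
    | zero => simp
    | add a b ha hb => simp only [smul_add, map_add, Finset.sum_add_distrib, ha, hb]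
    | single n a =>
      rw [Finsupp.linearCombination_single, id, ← aux_key a n]
      refine Finset.sum_congr rfl fun g _ => ?_
      rw [Finsupp.smul_single, smul_eq_mul, Finsupp.lsum_single]
      rfl
  refine ⟨L ∘ₗ s.restrictScalars R, fun v => ?_⟩
  have := hL (s v)
  rw [← LinearMap.comp_apply, hs] at this
  simpa using this

open MonoidAlgebra in
theorem aux_backward {R G V : Type} [CommRing R] [Group G] [Fintype G] [AddCommGroup V]
    [Module R V] [Module (MonoidAlgebra R G) V] [IsScalarTower R (MonoidAlgebra R G) V]
    (h : Module.Projective R V) (θ : V →ₗ[R] V)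
    (hθ : ∀ v, ∑ g : G, (single g⁻¹ (1 : R)) • θ (single g (1 : R) • v) = v) :
    Module.Projective (MonoidAlgebra R G) V := by
  refine Module.Projective.of_lifting_property'' fun f hf => ?_
  obtain ⟨t, ht⟩ := Module.projective_lifting_property (f.restrictScalars R)
    (LinearMap.id : V →ₗ[R] V) hf
  refine ⟨(t ∘ₗ θ).sumOfConjugatesEquivariant G, ?_⟩
  ext v
  have ht' : ∀ x, f (t x) = x := fun x => LinearMap.congr_fun ht x
  simp only [LinearMap.comp_apply, LinearMap.sumOfConjugatesEquivariant_apply, map_sum,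
    LinearMap.conjugate_apply, map_smul, ht', hθ, LinearMap.id_apply]


theorem aux_smul {R G V : Type} [CommRing R] [Group G] [AddCommGroup V]
    [Module R V] (ρ : Representation R G V) (g : G) (v : ρ.asModule) :
    (MonoidAlgebra.single g (1 : R)) • v = ρ.asModuleEquiv.symm (ρ g (ρ.asModuleEquiv v)) := by
  rw [Representation.single_smul, one_smul]
  rfl

theorem aux_rep_forward {R G V : Type} [CommRing R] [Group G] [Fintype G] [AddCommGroup V]
    [Module R V] (ρ : Representation R G V)
    (h : Module.Projective (MonoidAlgebra R G) ρ.asModule) :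
    Module.Projective R V ∧ ∃ θ : V →ₗ[R] V, ∀ v, ∑ g : G, ρ g⁻¹ (θ (ρ g v)) = v := by
  obtain ⟨p, θ, hθ⟩ := aux_forward h
  refine ⟨p, ρ.asModuleEquiv.toLinearMap ∘ₗ θ ∘ₗ ρ.asModuleEquiv.symm.toLinearMap, fun v => ?_⟩
  have := hθ (ρ.asModuleEquiv.symm v)
  simp only [aux_smul] at this
  exact this

theorem aux_rep_backward {R G V : Type} [CommRing R] [Group G] [Fintype G] [AddCommGroup V]
    [Module R V] (ρ : Representation R G V) (p : Module.Projective R V)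
    (θ : V →ₗ[R] V) (h : ∀ v, ∑ g : G, ρ g⁻¹ (θ (ρ g v)) = v) :
    Module.Projective (MonoidAlgebra R G) ρ.asModule := by
  have st : IsScalarTower R (MonoidAlgebra R G) ρ.asModule := inferInstance
  refine @aux_backward R G ρ.asModule _ _ _ _ _ _ st p
    (ρ.asModuleEquiv.symm.toLinearMap ∘ₗ θ ∘ₗ ρ.asModuleEquiv.toLinearMap) fun v => ?_
  simp only [aux_smul]
  exact h v

/-- Let `R` be a commutative ring and `G` a finite group.  If `M₁` and `M₂` are
projective modules over the group algebra `R[G]`, then the tensor product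
`M₁ ⊗_R M₂`, equipped with the diagonal `G`-action (formalized via the tensor
product `ρ₁.tprod ρ₂` of the corresponding representations, viewed again as an
`R[G]`-module via `Representation.asModule`), is again a projective `R[G]`-module. -/
theorem tprod_projective (R : Type) [CommRing R] (G : Type) [Group G] [Finite G]
    (M₁ M₂ : Type) [AddCommGroup M₁] [Module R M₁] [AddCommGroup M₂] [Module R M₂]
    (ρ₁ : Representation R G M₁) (ρ₂ : Representation R G M₂)
    (h₁ : Module.Projective (MonoidAlgebra R G) ρ₁.asModule)
    (h₂ : Module.Projective (MonoidAlgebra R G) ρ₂.asModule) :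
    Module.Projective (MonoidAlgebra R G) (ρ₁.tprod ρ₂).asModule := by
  classical
  have := Fintype.ofFinite G
  obtain ⟨p₁, θ', hθ'⟩ := aux_rep_forward ρ₁ h₁
  obtain ⟨p₂, -⟩ := aux_rep_forward ρ₂ h₂
  have p : Module.Projective R (TensorProduct R M₁ M₂) := inferInstance
  have key : ∀ v : TensorProduct R M₁ M₂,
      ∑ g : G, (ρ₁.tprod ρ₂) g⁻¹ (TensorProduct.map θ' LinearMap.id ((ρ₁.tprod ρ₂) g v)) = v := by
    intro v
    induction v using TensorProduct.induction_on with
    | zero => simp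
    | add a b ha hb => simp only [map_add, Finset.sum_add_distrib, ha, hb]
    | tmul a b =>
      simp only [Representation.tprod_apply, TensorProduct.map_tmul, LinearMap.id_apply,
        Representation.inv_self_apply, ← TensorProduct.sum_tmul, hθ']
  exact aux_rep_backward (ρ₁.tprod ρ₂) p (TensorProduct.map θ' LinearMap.id) key
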